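/- arXiv:1806.06110 — 7 statements merged into one kernel-verified Lean document; each statement's English description precedes it below -/
import Mathlib

section
/- Let n ≥ 1, let 1 ≤ u ≤ n, and let X ⊆ ℤⁿ be nonempty. Then every (c_u,c_u)-continuous function f : X → X has a fixed point if and only if X is a singleton. -/
/-- `p` and `q` in `ℤⁿ` are `c_u`-adjacent: they are distinct, each coordinate differs
by at most 1, and at most `u` coordinates differ (by exactly 1). -/
def cuAdjacent (n u : ℕ) (p q : Fin n → ℤ) : Prop :=
  p ≠ q ∧ (∀ i, |p i - q i| ≤ 1) ∧
    (Finset.univ.filter fun i => |p i - q i| = 1).card ≤ u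

theorem cuAdjacent.symm {n u : ℕ} {p q : Fin n → ℤ} (h : cuAdjacent n u p q) :
    cuAdjacent n u q p := by
  obtain ⟨hne, hle, hcard⟩ := h
  refine ⟨hne.symm, fun i => abs_sub_comm (p i) (q i) ▸ hle i, ?_⟩
  simpa only [abs_sub_comm (q _) (p _)] using hcard

/-- The map sending `a` to `b` and every other point to `a` has no fixed point, and it is
continuous if `a` and `b` are adjacent or no two points of `X` are adjacent. -/
theorem exists_continuous_fixedPoint_free {n u : ℕ} {X : Set (Fin n → ℤ)} {a b : X} (hab : a ≠ b)
    (h : cuAdjacent n u a.val b.val ∨ ∀ x y : X, ¬ cuAdjacent n u x.val y.val) :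
    ∃ f : X → X,
      (∀ x y : X, cuAdjacent n u x.val y.val →
        f x = f y ∨ cuAdjacent n u (f x).val (f y).val) ∧
      ∀ p : X, f p ≠ p := by
  classical
  refine ⟨fun x => if x = a then b else a, fun x y hxy => ?_, fun p => ?_⟩
  · rcases h with h | h
    · by_cases hx : x = a <;> by_cases hy : y = a <;> simp [hx, hy, h, h.symm]
    · exact absurd hxy (h x y)
  · by_cases hp : p = a
    · simpa [hp] using hab.symm
    · simpa [hp] using Ne.symm hp

/-- A digital image `(X, c_u)` has the fixed point property if and only if `X` is a
singleton. -/
theorem fixed_point_property_iff_singleton (n u : ℕ) (hn : 1 ≤ n) (hu1 : 1 ≤ u)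
    (hun : u ≤ n) (X : Set (Fin n → ℤ)) (hX : X.Nonempty) :
    (∀ f : X → X,
        (∀ x y : X, cuAdjacent n u x.val y.val →
          f x = f y ∨ cuAdjacent n u (f x).val (f y).val) →
        ∃ p : X, f p = p) ↔ ∃ a, X = {a} := by
  constructor
  · intro hfix
    rw [Set.exists_eq_singleton_iff_nonempty_subsingleton]
    refine ⟨hX, fun a ha b hb => by_contra fun hab => ?_⟩
    obtain ⟨c, d, hcd, h⟩ : ∃ c d : X, c ≠ d ∧
        (cuAdjacent n u c.val d.val ∨ ∀ x y : X, ¬ cuAdjacent n u x.val y.val) := by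
      by_cases hadj : ∃ x y : X, cuAdjacent n u x.val y.val
      · obtain ⟨x, y, hxy⟩ := hadj
        exact ⟨x, y, fun e => hxy.1 (congrArg Subtype.val e), Or.inl hxy⟩
      · push Not at hadj
        exact ⟨⟨a, ha⟩, ⟨b, hb⟩, fun e => hab (congrArg Subtype.val e), Or.inr hadj⟩
    obtain ⟨f, hf, hfree⟩ := exists_continuous_fixedPoint_free hcd h
    obtain ⟨p, hp⟩ := hfix f hf
    exact hfree p hp
  · rintro ⟨a, rfl⟩ f -
    exact ⟨⟨a, rfl⟩, Subsingleton.elim _ _⟩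
end

section
/- Let n ≥ 1, let 1 ≤ u ≤ n, let X ⊆ ℤⁿ, and let x₀, x₁ ∈ X be c_u-adjacent. Define g : X → X by g(x) = x₀ if x ≠ x₀ and g(x₀) = x₁. Then g is (c_u,c_u)-continuous and g has no fixed point. -/
open Classical in
/-- For `c_u`-adjacent points `x₀, x₁` of `X`, the map `g` sending `x₀` to `x₁` and every
other point to `x₀` is `(c_u,c_u)`-continuous and has no fixed point. -/
theorem flip_map_continuous_and_fixed_point_free (n u : ℕ) (hn : 1 ≤ n) (hu1 : 1 ≤ u)
    (hun : u ≤ n) (X : Set (Fin n → ℤ)) (x₀ x₁ : Fin n → ℤ)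
    (h₀ : x₀ ∈ X) (h₁ : x₁ ∈ X) (hadj : cuAdjacent n u x₀ x₁)
    (g : X → X)
    (hg : ∀ x : X, g x = if x.val = x₀ then (⟨x₁, h₁⟩ : X) else ⟨x₀, h₀⟩) :
    (∀ x y : X, cuAdjacent n u x.val y.val →
      g x = g y ∨ cuAdjacent n u (g x).val (g y).val) ∧
    ∀ p : X, g p ≠ p := by
  refine ⟨fun x y _ => ?_, fun p hp => ?_⟩
  · rw [hg x, hg y]
    split_ifs
    · exact Or.inl rfl
    · exact Or.inr hadj.symm
    · exact Or.inr hadj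
    · exact Or.inl rfl
  · have hval := congrArg Subtype.val ((hg p).symm.trans hp)
    split_ifs at hval with h
    · exact hadj.1 (h.symm.trans hval.symm)
    · exact h hval.symm
end

section
/- Let n ≥ 1, let 1 ≤ u ≤ n, and let X ⊆ ℤⁿ be c_u-connected with more than one point. Let f : X → X be any constant function. Then there exist m ∈ ℕ, a (c_u,c_u)-continuous function g : X → X with no fixed point, and a digital homotopy F : X × [0,m]_ℤ → X from f to g. -/
/-- `X ⊆ ℤⁿ` is `c_u`-connected: any two of its points are joined by a finite sequence
of points of `X` in which consecutive points are equal or `c_u`-adjacent. -/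
def cuConnected (n u : ℕ) (X : Set (Fin n → ℤ)) : Prop :=
  ∀ x ∈ X, ∀ y ∈ X, ∃ (k : ℕ) (c : ℕ → Fin n → ℤ),
    (∀ i ≤ k, c i ∈ X) ∧ c 0 = x ∧ c k = y ∧
    ∀ i < k, c i = c (i + 1) ∨ cuAdjacent n u (c i) (c (i + 1))

/-- A point of a `c_u`-connected set with another point has a neighbor in the set. -/
theorem cuConnected.exists_adjacent {n u : ℕ} {X : Set (Fin n → ℤ)}
    (hconn : cuConnected n u X) {x y : Fin n → ℤ} (hx : x ∈ X) (hy : y ∈ X) (hxy : x ≠ y) :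
    ∃ z ∈ X, cuAdjacent n u x z := by
  obtain ⟨k, c, hc, h0, hk, hstep⟩ := hconn x hx y hy
  by_contra! hno
  have hconst : ∀ i ≤ k, c i = x := by
    intro i
    induction i with
    | zero => exact fun _ => h0
    | succ i ih =>
      intro hi
      have hi' := ih (by omega)
      rcases hstep i (by omega) with h | h
      · exact h.symm.trans hi'
      · rw [hi'] at h
        exact absurd h (hno _ (hc _ hi))
  exact hxy ((hconst k le_rfl).symm.trans hk)

/-- On a `c_u`-connected digital image with more than one point, every constant map is
digitally homotopic to a `(c_u,c_u)`-continuous map with no fixed point. -/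
theorem constant_homotopic_to_fixed_point_free (n u : ℕ) (hn : 1 ≤ n) (hu1 : 1 ≤ u)
    (hun : u ≤ n) (X : Set (Fin n → ℤ)) (hconn : cuConnected n u X)
    (hbig : ∃ x y : X, x ≠ y)
    (f : X → X) (hf : ∃ c : X, ∀ x, f x = c) :
    ∃ (m : ℕ) (g : X → X) (F : X → Set.Icc (0 : ℤ) (m : ℤ) → X),
      -- g is (c_u,c_u)-continuous
      (∀ x y : X, cuAdjacent n u x.val y.val →
        g x = g y ∨ cuAdjacent n u (g x).val (g y).val) ∧
      -- g has no fixed point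
      (∀ p : X, g p ≠ p) ∧
      -- F is a homotopy from f to g:
      (∀ (x : X) (t : Set.Icc (0 : ℤ) (m : ℤ)),
        (t.val = 0 → F x t = f x) ∧ (t.val = m → F x t = g x)) ∧
      -- each stage of F is (c_u,c_u)-continuous
      (∀ (t : Set.Icc (0 : ℤ) (m : ℤ)) (x y : X), cuAdjacent n u x.val y.val →
        F x t = F y t ∨ cuAdjacent n u (F x t).val (F y t).val) ∧
      -- consecutive stages give equal or adjacent values
      (∀ (x : X) (t t' : Set.Icc (0 : ℤ) (m : ℤ)), t'.val = t.val + 1 →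
        F x t = F x t' ∨ cuAdjacent n u (F x t).val (F x t').val) := by
  classical
  obtain ⟨a, ha⟩ := hf
  obtain ⟨y, hy⟩ : ∃ y : X, y ≠ a := by
    obtain ⟨x, y, hxy⟩ := hbig
    by_cases h : x = a
    · exact ⟨y, fun h' => hxy (h.trans h'.symm)⟩
    · exact ⟨x, h⟩
  obtain ⟨b, hb, hab⟩ := hconn.exists_adjacent a.2 y.2 fun h => hy (Subtype.ext h.symm)
  lift b to X using hb
  have hne : b ≠ a := fun h => hab.1 (congrArg Subtype.val h.symm)
  -- any two values in `{a, b}` are equal or adjacent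
  have hpair : ∀ v w : X, (v = a ∨ v = b) → (w = a ∨ w = b) →
      v = w ∨ cuAdjacent n u v.val w.val := by
    rintro v w (rfl | rfl) (rfl | rfl)
    exacts [.inl rfl, .inr hab, .inr hab.symm, .inl rfl]
  have hg : ∀ x : X, (if x = a then b else a) = a ∨ (if x = a then b else a) = b := by
    intro x
    split_ifs <;> simp
  have hF : ∀ (x : X) (t : Set.Icc (0 : ℤ) ((1 : ℕ) : ℤ)),
      (if t.val = 0 then a else if x = a then b else a) = a ∨
        (if t.val = 0 then a else if x = a then b else a) = b := by
    intro x t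
    split_ifs <;> simp
  refine ⟨1, fun x => if x = a then b else a,
    fun x t => if t.val = 0 then a else if x = a then b else a,
    fun x y _ => hpair _ _ (hg x) (hg y), fun p => ?_, fun x t => ⟨fun h => ?_, fun h => ?_⟩,
    fun t x y _ => hpair _ _ (hF x t) (hF y t), fun x t t' _ => hpair _ _ (hF x t) (hF x t')⟩
  · by_cases h : p = a
    · simpa [h] using hne
    · simpa [h] using Ne.symm h
  · simp [h, ha]
  · simp [h]
end

section
/- Let n ≥ 1, let 1 ≤ u ≤ n, let X ⊆ ℤⁿ be nonempty, and let m ≥ 1. Then X (with the c_u-adjacency) has the digital fixed point property with respect to [0,m]_ℤ if and only if X is a singleton. -/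
open Classical in
/-- A digital image with at least two points has a continuous self-map without fixed points:
swap two adjacent points if there are any and send all other points to one of them; otherwise
every self-map is continuous. -/
theorem exists_continuous_selfMap_without_fixedPoint {n u : ℕ} {X : Set (Fin n → ℤ)}
    (hX : X.Nontrivial) :
    ∃ f : X → X, (∀ x y : X, cuAdjacent n u x.val y.val →
      f x = f y ∨ cuAdjacent n u (f x).val (f y).val) ∧ ∀ x, f x ≠ x := by
  have fixedPointFree (a b : X) (hab : a ≠ b) (x : X) : (if x = a then b else a) ≠ x := by
    split_ifs with h
    · exact fun hb => hab (h.symm.trans hb.symm)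
    · exact fun ha => h ha.symm
  by_cases h : ∃ a b : X, cuAdjacent n u a.val b.val
  · obtain ⟨a, b, hab⟩ := h
    refine ⟨fun x => if x = a then b else a, fun x y _ => ?_,
      fixedPointFree a b fun h => hab.1 (congrArg Subtype.val h)⟩
    dsimp only
    split_ifs
    · exact Or.inl rfl
    · exact Or.inr hab.symm
    · exact Or.inr hab
    · exact Or.inl rfl
  · obtain ⟨a, ha, b, hb, hab⟩ := hX
    exact ⟨fun x => if x = ⟨a, ha⟩ then ⟨b, hb⟩ else ⟨a, ha⟩, fun x y hxy => (h ⟨x, y, hxy⟩).elim,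
      fixedPointFree ⟨a, ha⟩ ⟨b, hb⟩ fun h => hab (congrArg Subtype.val h)⟩

/-- A nonempty digital image `(X, c_u)` has the digital fixed point property with respect
to `[0,m]_ℤ` (for any `m ≥ 1`) if and only if `X` is a singleton. Here the hypothesis
of the fixed point property quantifies over all `(κ_*, c_u)`-continuous maps
`F : X × [0,m]_ℤ → X`, where `κ_*` is the normal product adjacency, and asks for a
`c_u`-path of fixed points of the induced maps. -/
theorem digital_fixed_point_property_iff_singleton (n u : ℕ) (hn : 1 ≤ n) (hu1 : 1 ≤ u)
    (hun : u ≤ n) (X : Set (Fin n → ℤ)) (hX : X.Nonempty) (m : ℕ) (hm : 1 ≤ m) :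
    (∀ F : X × Set.Icc (0 : ℤ) (m : ℤ) → X,
        -- F is (κ_*, c_u)-continuous for the normal product adjacency κ_*
        (∀ a b : X × Set.Icc (0 : ℤ) (m : ℤ),
          ((cuAdjacent n u a.1.val b.1.val ∧ a.2 = b.2) ∨
           (a.1 = b.1 ∧ |a.2.val - b.2.val| = 1) ∨
           (cuAdjacent n u a.1.val b.1.val ∧ |a.2.val - b.2.val| = 1)) →
          F a = F b ∨ cuAdjacent n u (F a).val (F b).val) →
        -- there is a c_u-path of fixed points of the induced maps
        ∃ p : Set.Icc (0 : ℤ) (m : ℤ) → X,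
          (∀ t t' : Set.Icc (0 : ℤ) (m : ℤ), t'.val = t.val + 1 →
            p t = p t' ∨ cuAdjacent n u (p t).val (p t').val) ∧
          ∀ t : Set.Icc (0 : ℤ) (m : ℤ), F (p t, t) = p t) ↔
      ∃ a, X = {a} := by
  constructor
  · intro h
    refine (hX.exists_eq_singleton_or_nontrivial).resolve_right fun hnt => ?_
    obtain ⟨f, hf, hfix⟩ := exists_continuous_selfMap_without_fixedPoint (u := u) hnt
    obtain ⟨p, -, hp⟩ := h (fun x => f x.1) fun a b hab => by
      rcases hab with ⟨hadj, -⟩ | ⟨heq, -⟩ | ⟨hadj, -⟩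
      · exact hf _ _ hadj
      · exact Or.inl (congrArg f heq)
      · exact hf _ _ hadj
    exact hfix _ (hp ⟨0, le_rfl, Int.natCast_nonneg m⟩)
  · rintro ⟨a, rfl⟩ F -
    exact ⟨fun _ => ⟨a, rfl⟩, fun _ _ _ => Or.inl rfl, fun _ => Subsingleton.elim _ _⟩
end

section
/- Let n ≥ 4 and let y : ℤ/nℤ → ℤ² be injective such that for all i,j ∈ ℤ/nℤ, y(i) and y(j) are c₂-adjacent if and only if j = i+1 or j = i−1 (so the image Y of y is a digital simple closed curve with 8-adjacency). Then the function f : Y → Y defined by f(y(i)) = y(i+2) is well-defined and (c₂,c₂)-continuous, and for every i ∈ ℤ/nℤ, y(i+2) ≠ y(i) and y(i+2) is not c₂-adjacent to y(i). Hence f has no approximate fixed point, so (Y,8) does not have the approximate fixed point property. -/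
/-- `p` and `q` in `ℤ²` are `c₂`-adjacent (8-adjacent): they are distinct and each
coordinate differs by at most 1. -/
def adj8 (p q : ℤ × ℤ) : Prop :=
  p ≠ q ∧ |p.1 - q.1| ≤ 1 ∧ |p.2 - q.2| ≤ 1

theorem ZMod.natCast_ne_zero_of_pos_of_lt {n k : ℕ} (hk : 0 < k) (hkn : k < n) :
    (k : ZMod n) ≠ 0 := by
  rw [Ne, ZMod.natCast_eq_zero_iff]
  exact Nat.not_dvd_of_pos_of_lt hk hkn

/-- For a digital simple closed curve `Y` of `n ≥ 4` points with 8-adjacency,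
parametrized circularly by `y : ℤ/nℤ → ℤ²`, the map `y(i) ↦ y(i+2)` is a well-defined
`(c₂,c₂)`-continuous self-map of `Y`, `y(i+2)` is never equal or `c₂`-adjacent to `y(i)`,
so the map has no approximate fixed point and `(Y,8)` does not have the approximate
fixed point property. -/
theorem simple_closed_curve_no_AFPP (n : ℕ) (hn : 4 ≤ n) (y : ZMod n → ℤ × ℤ)
    (hinj : Function.Injective y)
    (hadj : ∀ i j : ZMod n, adj8 (y i) (y j) ↔ (j = i + 1 ∨ j = i - 1)) :
    (∃ f : Set.range y → Set.range y,
      -- f is well-defined by f(y(i)) = y(i+2)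
      (∀ i : ZMod n, f ⟨y i, ⟨i, rfl⟩⟩ = ⟨y (i + 2), ⟨i + 2, rfl⟩⟩) ∧
      -- f is (c₂,c₂)-continuous
      (∀ a b : Set.range y, adj8 a.val b.val → f a = f b ∨ adj8 (f a).val (f b).val) ∧
      -- f has no approximate fixed point
      (∀ p : Set.range y, ¬(f p = p ∨ adj8 (f p).val p.val))) ∧
    -- y(i+2) is neither equal nor c₂-adjacent to y(i)
    (∀ i : ZMod n, y (i + 2) ≠ y i ∧ ¬ adj8 (y (i + 2)) (y i)) ∧
    -- (Y,8) does not have the approximate fixed point property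
    ¬(∀ g : Set.range y → Set.range y,
        (∀ a b : Set.range y, adj8 a.val b.val → g a = g b ∨ adj8 (g a).val (g b).val) →
        ∃ p : Set.range y, g p = p ∨ adj8 (g p).val p.val) := by
  have h1 : (1 : ZMod n) ≠ 0 := by
    exact_mod_cast ZMod.natCast_ne_zero_of_pos_of_lt (k := 1) (by omega) (by omega)
  have h2 : (2 : ZMod n) ≠ 0 := by
    exact_mod_cast ZMod.natCast_ne_zero_of_pos_of_lt (k := 2) (by omega) (by omega)
  have h3 : (3 : ZMod n) ≠ 0 := by
    exact_mod_cast ZMod.natCast_ne_zero_of_pos_of_lt (k := 3) (by omega) (by omega)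
  have far (i : ZMod n) : y (i + 2) ≠ y i ∧ ¬ adj8 (y (i + 2)) (y i) := by
    refine ⟨fun h => h2 (by linear_combination hinj h), fun h => ?_⟩
    rcases (hadj _ _).1 h with h | h
    · exact h3 (by linear_combination -h)
    · exact h1 (by linear_combination -h)
  let e := Equiv.ofInjective y hinj
  let f : Set.range y → Set.range y := fun p => e (e.symm p + 2)
  have hf (i : ZMod n) : f ⟨y i, ⟨i, rfl⟩⟩ = ⟨y (i + 2), ⟨i + 2, rfl⟩⟩ :=
    congrArg (fun j => e (j + 2)) (e.symm_apply_apply i)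
  have hcont (a b : Set.range y) (hab : adj8 a.val b.val) :
      f a = f b ∨ adj8 (f a).val (f b).val := by
    obtain ⟨_, i, rfl⟩ := a
    obtain ⟨_, j, rfl⟩ := b
    right
    rw [hf, hf, hadj]
    rcases (hadj i j).1 hab with rfl | rfl
    · left; ring
    · right; ring
  have hfix (p : Set.range y) : ¬(f p = p ∨ adj8 (f p).val p.val) := by
    obtain ⟨_, i, rfl⟩ := p
    rw [hf, not_or]
    exact ⟨fun h => (far i).1 (congrArg Subtype.val h), (far i).2⟩
  exact ⟨⟨f, hf, hcont, hfix⟩, far, fun h => (h f hcont).elim hfix⟩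
end

section
/- Let (X,d) be a metric space, let κ be an adjacency relation on X, and let M₁ ≥ M₂ > 0 be constants such that d(x,y) ≥ M₂ whenever x,y ∈ X are distinct and d(x,y) ≤ M₁ whenever x,y ∈ X are κ-adjacent. Suppose X is κ-connected. If f : X → X satisfies d(f(x),f(y)) ≤ α·d(x,y) for all x,y ∈ X, for some α with 0 < α < M₂/M₁, then f is a constant function. -/
/-- Let `(X,d)` be a metric space with a symmetric adjacency relation `κ` under which `X`
is connected, with constants `M₁ ≥ M₂ > 0` such that distinct points are at distance at
least `M₂` and `κ`-adjacent points are at distance at most `M₁`. Then any digital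
contraction map on `X` with multiplier `α < M₂ / M₁` is a constant function. -/
theorem contraction_constant_of_bounds {X : Type*} [MetricSpace X]
    (κ : X → X → Prop) (hsymm : ∀ x y, κ x y → κ y x)
    (M₁ M₂ : ℝ) (hM : M₂ ≤ M₁) (hM₂ : 0 < M₂)
    (hmin : ∀ x y : X, x ≠ y → M₂ ≤ dist x y)
    (hadjd : ∀ x y : X, κ x y → dist x y ≤ M₁)
    (hconn : ∀ x y : X, ∃ (k : ℕ) (c : ℕ → X),
      c 0 = x ∧ c k = y ∧ ∀ i < k, c i = c (i + 1) ∨ κ (c i) (c (i + 1)))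
    (f : X → X) (α : ℝ) (hα0 : 0 < α) (hα1 : α < M₂ / M₁)
    (hf : ∀ x y : X, dist (f x) (f y) ≤ α * dist x y) :
    ∀ x y : X, f x = f y := by
  have hM₁ : 0 < M₁ := hM₂.trans_le hM
  have hstep : ∀ x y : X, κ x y → f x = f y := by
    intro x y hxy
    by_contra hne
    have hle := (hf x y).trans (mul_le_mul_of_nonneg_left (hadjd x y hxy) hα0.le)
    exact absurd ((hmin _ _ hne).trans hle) (not_le.mpr ((lt_div_iff₀ hM₁).mp hα1))
  intro x y
  obtain ⟨k, c, rfl, rfl, hc⟩ := hconn x y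
  induction k with
  | zero => rfl
  | succ n ih =>
    have hlast : f (c n) = f (c (n + 1)) :=
      (hc n n.lt_succ_self).elim (congrArg f) (hstep _ _)
    exact (ih fun i hi => hc i (hi.trans n.lt_succ_self)).trans hlast
end

section
/- Let (X,d) be a metric space with more than one point in which the minimum positive distance is attained: there exist x₀,y₀ ∈ X with d(x₀,y₀) > 0 such that d(x₀,y₀) ≤ d(x,y) for all x,y ∈ X with x ≠ y. Then there is no map T : X → X that is surjective and a digital expansive mapping, i.e., there is no surjective T : X → X satisfying d(T(x),T(y)) ≥ k·d(x,y) for all x,y ∈ X for some constant k > 1. -/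
/-- A metric space with more than one point in which the minimum positive distance is
attained admits no surjective digital expansive mapping. -/
theorem no_surjective_expansive_of_attained_min_distance {X : Type*} [MetricSpace X]
    (x₀ y₀ : X) (hpos : 0 < dist x₀ y₀)
    (hmin : ∀ x y : X, x ≠ y → dist x₀ y₀ ≤ dist x y) :
    ¬ ∃ (T : X → X) (k : ℝ), Function.Surjective T ∧ 1 < k ∧
        ∀ x y : X, k * dist x y ≤ dist (T x) (T y) := by
  rintro ⟨T, k, hT, hk, hexp⟩
  obtain ⟨a, rfl⟩ := hT x₀
  obtain ⟨b, rfl⟩ := hT y₀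
  have hab : a ≠ b := by
    rintro rfl
    simp at hpos
  nlinarith [hmin a b hab, hexp a b, dist_pos.mpr hab]
end
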